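/- Let n ≥ 1 and α ∈ [0,1). There is a constant C = C(n,α) > 0 such that for every measurable f : ℝⁿ → ℂ with ‖f‖_{Q_α^{-1}} < ∞ and every t > 0, the heat extension satisfies t^{1/2} ‖e^{tΔ}f‖_{L^∞(ℝⁿ)} ≤ C ‖f‖_{Q_α^{-1}}. -/

import Mathlib

open MeasureTheory Metric Real
open scoped ENNReal NNReal

noncomputable section

/-- The heat extension `e^{tΔ}f` of a function `f : ℝⁿ → ℂ`. -/
def heatExt (n : ℕ) (f : EuclideanSpace ℝ (Fin n) → ℂ) (t : ℝ)
    (x : EuclideanSpace ℝ (Fin n)) : ℂ :=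
  ∫ y, ((4 * π * t) ^ (-(n : ℝ) / 2) * Real.exp (-‖x - y‖ ^ 2 / (4 * t))) • f y

/-- The `Q_α^{-1}` norm of `f`. -/
def QinvNorm (n : ℕ) (α : ℝ) (f : EuclideanSpace ℝ (Fin n) → ℂ) : ℝ≥0∞ :=
  ⨆ (r : ℝ) (_ : 0 < r) (x : EuclideanSpace ℝ (Fin n)),
    (ENNReal.ofReal (r ^ (2 * α - (n : ℝ))) *
      ∫⁻ t in Set.Ioo (0 : ℝ) (r ^ 2),
        (∫⁻ y in Metric.ball x r, (‖heatExt n f t y‖₊ : ℝ≥0∞) ^ 2) *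
          ENNReal.ofReal (t ^ (-α))) ^ (1 / 2 : ℝ)

/-- The heat kernel on `ℝⁿ`. -/
def heatKernel (n : ℕ) (t : ℝ) (w : EuclideanSpace ℝ (Fin n)) : ℝ :=
  (4 * π * t) ^ (-(n : ℝ) / 2) * Real.exp (-‖w‖ ^ 2 / (4 * t))

lemma heatKernel_nonneg {n : ℕ} {t : ℝ} (ht : 0 < t) (w : EuclideanSpace ℝ (Fin n)) :
    0 ≤ heatKernel n t w := by
  unfold heatKernel
  positivity

lemma measurable_heatKernel_uncurry (n : ℕ) :
    Measurable fun p : ℝ × EuclideanSpace ℝ (Fin n) => heatKernel n p.1 p.2 := by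
  unfold heatKernel
  fun_prop

@[fun_prop]
lemma measurable_heatKernel (n : ℕ) (t : ℝ) : Measurable (heatKernel n t) := by
  unfold heatKernel
  fun_prop

lemma integral_exp_neg_mul_norm_sub_sq {n : ℕ} {b : ℝ} (hb : 0 < b)
    (x : EuclideanSpace ℝ (Fin n)) :
    ∫ y, Real.exp (-b * ‖y - x‖ ^ 2) = (π / b) ^ ((n : ℝ) / 2) := by
  rw [integral_sub_right_eq_self (fun y : EuclideanSpace ℝ (Fin n) => Real.exp (-b * ‖y‖ ^ 2)) x,
    GaussianFourier.integral_rexp_neg_mul_sq_norm hb]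
  simp

lemma integrable_exp_neg_mul_norm_sub_sq {n : ℕ} {b : ℝ} (hb : 0 < b)
    (x : EuclideanSpace ℝ (Fin n)) :
    Integrable fun y => Real.exp (-b * ‖y - x‖ ^ 2) := by
  refine Integrable.of_integral_ne_zero ?_
  rw [integral_exp_neg_mul_norm_sub_sq hb]
  positivity

lemma lintegral_exp_neg_mul_norm_sub_sq {n : ℕ} {b : ℝ} (hb : 0 < b)
    (x : EuclideanSpace ℝ (Fin n)) :
    ∫⁻ y, ENNReal.ofReal (Real.exp (-b * ‖y - x‖ ^ 2)) =
      ENNReal.ofReal ((π / b) ^ ((n : ℝ) / 2)) := by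
  rw [← integral_exp_neg_mul_norm_sub_sq hb x, ofReal_integral_eq_lintegral_ofReal
    (integrable_exp_neg_mul_norm_sub_sq hb x) (.of_forall fun y => (Real.exp_pos _).le)]

lemma lintegral_heatKernel {n : ℕ} {t : ℝ} (ht : 0 < t) (x : EuclideanSpace ℝ (Fin n)) :
    ∫⁻ y, ENNReal.ofReal (heatKernel n t (x - y)) = 1 := by
  have h (y : EuclideanSpace ℝ (Fin n)) : ENNReal.ofReal (heatKernel n t (x - y)) =
      ENNReal.ofReal ((4 * π * t) ^ (-(n : ℝ) / 2)) *
        ENNReal.ofReal (Real.exp (-(1 / (4 * t)) * ‖y - x‖ ^ 2)) := by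
    rw [← ENNReal.ofReal_mul (by positivity), norm_sub_rev, heatKernel]
    congr 3
    ring
  simp_rw [h]
  rw [lintegral_const_mul _ (by fun_prop), lintegral_exp_neg_mul_norm_sub_sq (by positivity),
    ← ENNReal.ofReal_mul (by positivity), show π / (1 / (4 * t)) = 4 * π * t by field_simp,
    ← Real.rpow_add (by positivity), neg_div, neg_add_cancel, Real.rpow_zero, ENNReal.ofReal_one]

lemma norm_sub_sq_div_add_norm_sq_div {E : Type*} [NormedAddCommGroup E] [InnerProductSpace ℝ E]
    {a b : ℝ} (ha : 0 < a) (hb : 0 < b) (p q : E) :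
    ‖p - q‖ ^ 2 / a + ‖q‖ ^ 2 / b =
      ‖p‖ ^ 2 / (a + b) + (a + b) / (a * b) * ‖q - (b / (a + b)) • p‖ ^ 2 := by
  rw [norm_sub_sq_real, norm_sub_sq_real, norm_smul, inner_smul_right, real_inner_comm,
    Real.norm_of_nonneg (by positivity)]
  field_simp
  ring

lemma heatKernel_mul_heatKernel {n : ℕ} {a b : ℝ} (ha : 0 < a) (hb : 0 < b)
    (x y z : EuclideanSpace ℝ (Fin n)) :
    heatKernel n a (x - y) * heatKernel n b (y - z) =
      heatKernel n (a + b) (x - z) * ((4 * π * (a * b / (a + b))) ^ (-(n : ℝ) / 2) *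
        Real.exp (-((a + b) / (4 * (a * b))) * ‖y - (z + (b / (a + b)) • (x - z))‖ ^ 2)) := by
  have h := norm_sub_sq_div_add_norm_sq_div ha hb (x - z) (y - z)
  rw [sub_sub_sub_cancel_right, sub_sub] at h
  unfold heatKernel
  rw [mul_mul_mul_comm, mul_mul_mul_comm ((4 * π * (a + b)) ^ (-(n : ℝ) / 2)), ← Real.exp_add, ← Real.exp_add,
    ← Real.mul_rpow (by positivity) (by positivity),
    ← Real.mul_rpow (by positivity) (by positivity)]
  congr 2
  · field_simp
  · have e1 : -‖x - y‖ ^ 2 / (4 * a) + -‖y - z‖ ^ 2 / (4 * b) =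
        -(1 / 4) * (‖x - y‖ ^ 2 / a + ‖y - z‖ ^ 2 / b) := by field_simp; ring
    rw [e1, h]
    field_simp
    ring

lemma integral_heatKernel_mul_heatKernel {n : ℕ} {a b : ℝ} (ha : 0 < a) (hb : 0 < b)
    (x z : EuclideanSpace ℝ (Fin n)) :
    ∫ y, heatKernel n a (x - y) * heatKernel n b (y - z) = heatKernel n (a + b) (x - z) := by
  simp_rw [heatKernel_mul_heatKernel ha hb]
  rw [integral_const_mul, integral_const_mul, integral_exp_neg_mul_norm_sub_sq (by positivity),
    show π / ((a + b) / (4 * (a * b))) = 4 * π * (a * b / (a + b)) by field_simp,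
    ← Real.rpow_add (by positivity), neg_div, neg_add_cancel, Real.rpow_zero, mul_one]

lemma integrable_heatKernel_mul_heatKernel {n : ℕ} {a b : ℝ} (ha : 0 < a) (hb : 0 < b)
    (x z : EuclideanSpace ℝ (Fin n)) :
    Integrable fun y => heatKernel n a (x - y) * heatKernel n b (y - z) := by
  simp_rw [heatKernel_mul_heatKernel ha hb]
  exact ((integrable_exp_neg_mul_norm_sub_sq (by positivity) _).const_mul _).const_mul _

lemma heatExt_eq (n : ℕ) (f : EuclideanSpace ℝ (Fin n) → ℂ) (t : ℝ)
    (x : EuclideanSpace ℝ (Fin n)) : heatExt n f t x = ∫ y, heatKernel n t (x - y) • f y := rfl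

lemma measurable_heatExt_uncurry {n : ℕ} {f : EuclideanSpace ℝ (Fin n) → ℂ} (hf : Measurable f) :
    Measurable fun p : ℝ × EuclideanSpace ℝ (Fin n) => heatExt n f p.1 p.2 := by
  simp_rw [heatExt_eq]
  refine (StronglyMeasurable.integral_prod_right' (f := fun q : (ℝ × EuclideanSpace ℝ (Fin n)) ×
    EuclideanSpace ℝ (Fin n) => heatKernel n q.1.1 (q.1.2 - q.2) • f q.2) ?_).measurable
  refine Measurable.stronglyMeasurable (Measurable.smul
    (f := fun q : (ℝ × EuclideanSpace ℝ (Fin n)) × EuclideanSpace ℝ (Fin n) =>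
      heatKernel n q.1.1 (q.1.2 - q.2)) ?_ (hf.comp measurable_snd))
  exact (measurable_heatKernel_uncurry n).comp (g := fun p => heatKernel n p.1 p.2)
    (f := fun q : (ℝ × EuclideanSpace ℝ (Fin n)) × EuclideanSpace ℝ (Fin n) =>
      (q.1.1, q.1.2 - q.2)) (by fun_prop)

/-- The semigroup property, at a point where the heat extension converges absolutely. -/
lemma heatExt_add {n : ℕ} {f : EuclideanSpace ℝ (Fin n) → ℂ} (hf : Measurable f) {a b : ℝ}
    (ha : 0 < a) (hb : 0 < b) (x : EuclideanSpace ℝ (Fin n))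
    (hx : Integrable fun z => heatKernel n (a + b) (x - z) • f z) :
    heatExt n f (a + b) x = ∫ y, heatKernel n a (x - y) • heatExt n f b y := by
  have hint : Integrable (Function.uncurry fun y z : EuclideanSpace ℝ (Fin n) =>
      (heatKernel n a (x - y) * heatKernel n b (y - z)) • f z) (volume.prod volume) := by
    rw [integrable_prod_iff' (by
      refine Measurable.aestronglyMeasurable ?_
      unfold Function.uncurry
      fun_prop)]
    refine ⟨.of_forall fun z => (integrable_heatKernel_mul_heatKernel ha hb x z).smul_const (f z), ?_⟩
    convert hx.norm using 2 with z
    simp only [Function.uncurry, norm_smul]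
    rw [integral_mul_const, Real.norm_of_nonneg (heatKernel_nonneg (by positivity) _),
      ← integral_heatKernel_mul_heatKernel ha hb]
    congr 2
    ext y
    exact Real.norm_of_nonneg (mul_nonneg (heatKernel_nonneg ha _) (heatKernel_nonneg hb _))
  simp_rw [heatExt_eq, ← integral_smul, smul_smul]
  rw [integral_integral_swap hint]
  simp_rw [integral_smul_const, integral_heatKernel_mul_heatKernel ha hb]

/-- Jensen's inequality for the heat semigroup. -/
lemma enorm_heatExt_add_sq_le {n : ℕ} {f : EuclideanSpace ℝ (Fin n) → ℂ} (hf : Measurable f)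
    {a b : ℝ} (ha : 0 < a) (hb : 0 < b) (x : EuclideanSpace ℝ (Fin n)) :
    ‖heatExt n f (a + b) x‖ₑ ^ 2 ≤
      ∫⁻ y, ENNReal.ofReal (heatKernel n a (x - y)) * ‖heatExt n f b y‖ₑ ^ 2 := by
  by_cases hx : Integrable fun z => heatKernel n (a + b) (x - z) • f z
  swap
  · rw [heatExt_eq, integral_undef hx]
    simp
  have hu : Measurable fun y => ‖heatExt n f b y‖ₑ :=
    ((measurable_heatExt_uncurry hf).comp measurable_prodMk_left).enorm
  have hk : Measurable fun y => ENNReal.ofReal (heatKernel n a (x - y)) := by fun_prop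
  set ν := (volume : Measure (EuclideanSpace ℝ (Fin n))).withDensity
    fun y => ENNReal.ofReal (heatKernel n a (x - y)) with hν
  have hν1 : ν Set.univ = 1 := by
    rw [hν, withDensity_apply _ .univ, setLIntegral_univ, lintegral_heatKernel ha]
  have h1 : ‖heatExt n f (a + b) x‖ₑ ≤ ∫⁻ y, ‖heatExt n f b y‖ₑ ∂ν := by
    rw [heatExt_add hf ha hb x hx, hν, lintegral_withDensity_eq_lintegral_mul _ hk hu]
    refine (enorm_integral_le_lintegral_enorm _).trans_eq (lintegral_congr fun y => ?_)
    rw [enorm_smul, Real.enorm_of_nonneg (heatKernel_nonneg ha _), Pi.mul_apply]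
  have h2 : ∫⁻ y, ‖heatExt n f b y‖ₑ ∂ν ≤ (∫⁻ y, ‖heatExt n f b y‖ₑ ^ 2 ∂ν) ^ (1 / 2 : ℝ) := by
    have := ENNReal.lintegral_mul_le_Lp_mul_Lq ν Real.HolderConjugate.two_two
      hu.aemeasurable (aemeasurable_const (b := (1 : ℝ≥0∞)))
    simpa [hν1] using this
  calc ‖heatExt n f (a + b) x‖ₑ ^ 2
      ≤ ((∫⁻ y, ‖heatExt n f b y‖ₑ ^ 2 ∂ν) ^ (1 / 2 : ℝ)) ^ 2 := by gcongr; exact h1.trans h2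
    _ = ∫⁻ y, ‖heatExt n f b y‖ₑ ^ 2 ∂ν := by
      rw [← ENNReal.rpow_natCast, ← ENNReal.rpow_mul]; norm_num
    _ = _ := by rw [hν, lintegral_withDensity_eq_lintegral_mul _ hk (hu.pow_const 2)]; rfl

lemma setLIntegral_le_QinvNorm_sq {n : ℕ} (α : ℝ) (f : EuclideanSpace ℝ (Fin n) → ℂ) {r : ℝ}
    (hr : 0 < r) (z : EuclideanSpace ℝ (Fin n)) :
    ∫⁻ t in Set.Ioo (0 : ℝ) (r ^ 2), (∫⁻ y in Metric.ball z r, ‖heatExt n f t y‖ₑ ^ 2) *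
      ENNReal.ofReal (t ^ (-α)) ≤ ENNReal.ofReal (r ^ ((n : ℝ) - 2 * α)) * QinvNorm n α f ^ 2 := by
  set I := ∫⁻ t in Set.Ioo (0 : ℝ) (r ^ 2), (∫⁻ y in Metric.ball z r, ‖heatExt n f t y‖ₑ ^ 2) *
      ENNReal.ofReal (t ^ (-α)) with hI
  have h : (ENNReal.ofReal (r ^ (2 * α - (n : ℝ))) * I) ^ (1 / 2 : ℝ) ≤ QinvNorm n α f :=
    le_iSup_of_le r (le_iSup_of_le hr (le_iSup_of_le z le_rfl))
  have h2 : ENNReal.ofReal (r ^ (2 * α - (n : ℝ))) * I ≤ QinvNorm n α f ^ 2 := by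
    calc _ = ((ENNReal.ofReal (r ^ (2 * α - (n : ℝ))) * I) ^ (1 / 2 : ℝ)) ^ 2 := by
          rw [← ENNReal.rpow_natCast, ← ENNReal.rpow_mul]; norm_num
      _ ≤ _ := by gcongr
  calc I = ENNReal.ofReal (r ^ ((n : ℝ) - 2 * α)) * (ENNReal.ofReal (r ^ (2 * α - (n : ℝ))) * I) := by
        rw [← mul_assoc, ← ENNReal.ofReal_mul (by positivity), ← Real.rpow_add hr]
        simp
    _ ≤ _ := by gcongr

lemma heatKernel_le {n : ℕ} {r a : ℝ} (hr : 0 < r) (h1 : r ^ 2 ≤ a) (h2 : a ≤ 2 * r ^ 2)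
    {w v : EuclideanSpace ℝ (Fin n)} (hwv : ‖v - w‖ ≤ r) :
    heatKernel n a w ≤ (4 * π * r ^ 2) ^ (-(n : ℝ) / 2) * Real.exp (1 / 8) *
      Real.exp (-(1 / (16 * r ^ 2)) * ‖v‖ ^ 2) := by
  have ha : 0 < a := lt_of_lt_of_le (by positivity) h1
  rw [mul_assoc, ← Real.exp_add, heatKernel]
  gcongr ?_ * ?_
  · refine Real.rpow_le_rpow_of_nonpos (by positivity) (by gcongr) ?_
    have : (0 : ℝ) ≤ n := n.cast_nonneg
    linarith
  · rw [Real.exp_le_exp]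
    have h3 : ‖v‖ ^ 2 ≤ 2 * ‖w‖ ^ 2 + 2 * r ^ 2 := by
      have : ‖v‖ ≤ ‖w‖ + r := by
        calc ‖v‖ = ‖w + (v - w)‖ := by congr 1; abel
          _ ≤ ‖w‖ + r := (norm_add_le _ _).trans (by gcongr)
      nlinarith [norm_nonneg v, norm_nonneg w, sq_nonneg (‖w‖ - r)]
    calc -‖w‖ ^ 2 / (4 * a) ≤ -‖w‖ ^ 2 / (4 * (2 * r ^ 2)) := by
          rw [neg_div, neg_div]; gcongr
      _ ≤ _ := by
          rw [show 1 / 8 + -(1 / (16 * r ^ 2)) * ‖v‖ ^ 2 = (2 * r ^ 2 - ‖v‖ ^ 2) / (16 * r ^ 2) by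
            field_simp; ring, show -‖w‖ ^ 2 / (4 * (2 * r ^ 2)) = -(2 * ‖w‖ ^ 2) / (16 * r ^ 2) by
            field_simp; ring]
          gcongr
          linarith

/-- A Gaussian average at scale `r` is controlled by a Gaussian average of integrals over balls of
radius `r`. -/
lemma volume_ball_mul_lintegral_heatKernel_le {n : ℕ} {r a : ℝ} (hr : 0 < r) (h1 : r ^ 2 ≤ a)
    (h2 : a ≤ 2 * r ^ 2) {g : EuclideanSpace ℝ (Fin n) → ℝ≥0∞} (hg : Measurable g)
    (x : EuclideanSpace ℝ (Fin n)) :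
    volume (ball (0 : EuclideanSpace ℝ (Fin n)) r) *
        ∫⁻ y, ENNReal.ofReal (heatKernel n a (x - y)) * g y ≤
      ENNReal.ofReal ((4 * π * r ^ 2) ^ (-(n : ℝ) / 2) * Real.exp (1 / 8)) *
        ∫⁻ z, ENNReal.ofReal (Real.exp (-(1 / (16 * r ^ 2)) * ‖z - x‖ ^ 2)) *
          ∫⁻ y in ball z r, g y := by
  classical
  set c := (4 * π * r ^ 2) ^ (-(n : ℝ) / 2) * Real.exp (1 / 8) with hc
  have hc0 : 0 ≤ c := by positivity
  have hS : MeasurableSet {p : EuclideanSpace ℝ (Fin n) × EuclideanSpace ℝ (Fin n) |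
      dist p.1 p.2 < r} := measurableSet_lt (by fun_prop) (by fun_prop)
  calc _ = ∫⁻ y, ∫⁻ z in ball y r, ENNReal.ofReal (heatKernel n a (x - y)) * g y := by
        rw [← lintegral_const_mul _ (by fun_prop)]
        refine lintegral_congr fun y => ?_
        rw [setLIntegral_const, mul_comm, Measure.addHaar_ball_center volume y r]
    _ ≤ ∫⁻ y, ∫⁻ z in ball y r, ENNReal.ofReal c *
          (ENNReal.ofReal (Real.exp (-(1 / (16 * r ^ 2)) * ‖z - x‖ ^ 2)) * g y) := by
        refine lintegral_mono fun y => setLIntegral_mono (by fun_prop) fun z hz => ?_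
        rw [← mul_assoc, ← ENNReal.ofReal_mul hc0]
        gcongr
        rw [norm_sub_rev z x]
        refine heatKernel_le hr h1 h2 ?_
        rw [sub_sub_sub_cancel_left, ← dist_eq_norm, dist_comm]
        exact (mem_ball.1 hz).le
    _ = ∫⁻ y, ∫⁻ z, ENNReal.ofReal c * {p : EuclideanSpace ℝ (Fin n) × EuclideanSpace ℝ (Fin n) |
          dist p.1 p.2 < r}.indicator (fun p =>
          ENNReal.ofReal (Real.exp (-(1 / (16 * r ^ 2)) * ‖p.2 - x‖ ^ 2)) * g p.1) (y, z) := by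
        refine lintegral_congr fun y => ?_
        rw [← lintegral_indicator measurableSet_ball]
        refine lintegral_congr fun z => ?_
        simp [Set.indicator_apply, dist_comm]
    _ = ∫⁻ z, ∫⁻ y, ENNReal.ofReal c * {p : EuclideanSpace ℝ (Fin n) × EuclideanSpace ℝ (Fin n) |
          dist p.1 p.2 < r}.indicator (fun p =>
          ENNReal.ofReal (Real.exp (-(1 / (16 * r ^ 2)) * ‖p.2 - x‖ ^ 2)) * g p.1) (y, z) := by
        refine lintegral_lintegral_swap (Measurable.aemeasurable ?_)
        refine Measurable.const_mul ?_ _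
        exact Measurable.indicator (by fun_prop) hS
    _ = ∫⁻ z, ENNReal.ofReal c *
          (ENNReal.ofReal (Real.exp (-(1 / (16 * r ^ 2)) * ‖z - x‖ ^ 2)) * ∫⁻ y in ball z r, g y) := by
        refine lintegral_congr fun z => ?_
        rw [← lintegral_const_mul _ hg, ← lintegral_const_mul _ (by fun_prop),
          ← lintegral_indicator measurableSet_ball]
        refine lintegral_congr fun y => ?_
        simp [Set.indicator_apply]
    _ = _ := by
        rw [lintegral_const_mul' _ _ ENNReal.ofReal_ne_top]

lemma measurable_setLIntegral_ball {n : ℕ} {F : ℝ × EuclideanSpace ℝ (Fin n) → ℝ≥0∞}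
    (hF : Measurable F) (r : ℝ) :
    Measurable fun p : EuclideanSpace ℝ (Fin n) × ℝ => ∫⁻ y in ball p.1 r, F (p.2, y) := by
  classical
  have hS : MeasurableSet {q : (EuclideanSpace ℝ (Fin n) × ℝ) × EuclideanSpace ℝ (Fin n) |
      dist q.2 q.1.1 < r} := measurableSet_lt (by fun_prop) (by fun_prop)
  have hu : Measurable fun q : (EuclideanSpace ℝ (Fin n) × ℝ) × EuclideanSpace ℝ (Fin n) =>
      F (q.1.2, q.2) := hF.comp (by fun_prop)
  have h := (hu.indicator hS).lintegral_prod_right' (ν := volume)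
  have he (p : EuclideanSpace ℝ (Fin n) × ℝ) : ∫⁻ y in ball p.1 r, F (p.2, y) =
      ∫⁻ y, {q : (EuclideanSpace ℝ (Fin n) × ℝ) × EuclideanSpace ℝ (Fin n) |
        dist q.2 q.1.1 < r}.indicator (fun q => F (q.1.2, q.2)) (p, y) := by
    rw [← lintegral_indicator measurableSet_ball]
    refine lintegral_congr fun y => ?_
    simp [Set.indicator_apply]
  simp_rw [he]
  exact h

lemma gaussian_const_mul {n : ℕ} {r : ℝ} (hr : 0 < r) :
    (4 * π * r ^ 2) ^ (-(n : ℝ) / 2) * Real.exp (1 / 8) *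
      (π / (1 / (16 * r ^ 2))) ^ ((n : ℝ) / 2) = 2 ^ n * Real.exp (1 / 8) := by
  have h4 : (4 : ℝ) ^ ((n : ℝ) / 2) = 2 ^ n := by
    rw [show (4 : ℝ) = 2 ^ (2 : ℝ) by norm_num, ← Real.rpow_mul (by norm_num),
      mul_div_cancel₀ _ two_ne_zero, Real.rpow_natCast]
  rw [show π / (1 / (16 * r ^ 2)) = 4 * (4 * π * r ^ 2) by field_simp; norm_num,
    Real.mul_rpow (x := 4) (y := 4 * π * r ^ 2) (by positivity) (by positivity), h4, neg_div, Real.rpow_neg (by positivity)]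
  have : (0 : ℝ) < (4 * π * r ^ 2) ^ ((n : ℝ) / 2) := by positivity
  field_simp

lemma setLIntegral_lintegral_mul_swap {X : Type*} [MeasurableSpace X] {μ : Measure X} [SFinite μ]
    {E : X → ℝ≥0∞} (hE : Measurable E) {G : X × ℝ → ℝ≥0∞} (hG : Measurable G) {w : ℝ → ℝ≥0∞}
    (hw : Measurable w) (S : Set ℝ) :
    ∫⁻ s in S, (∫⁻ z, E z * G (z, s) ∂μ) * w s =
      ∫⁻ z, (E z * ∫⁻ s in S, G (z, s) * w s) ∂μ := by
  have h1 (s : ℝ) : (∫⁻ z, E z * G (z, s) ∂μ) * w s = ∫⁻ z, E z * (G (z, s) * w s) ∂μ := by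
    rw [← lintegral_mul_const _ (by fun_prop)]
    simp_rw [mul_assoc]
  simp_rw [h1]
  rw [lintegral_lintegral_swap (by unfold Function.uncurry; fun_prop)]
  refine lintegral_congr fun z => ?_
  rw [lintegral_const_mul _ (by fun_prop)]

lemma volume_ball_mul_enorm_heatExt_sq_le {n : ℕ}
    {f : EuclideanSpace ℝ (Fin n) → ℂ} (hf : Measurable f) {r s : ℝ} (hs : s ∈ Set.Ioo 0 (r ^ 2))
    (hr : 0 < r) (x : EuclideanSpace ℝ (Fin n)) :
    volume (ball (0 : EuclideanSpace ℝ (Fin n)) r) * ‖heatExt n f (2 * r ^ 2) x‖ₑ ^ 2 ≤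
      ENNReal.ofReal ((4 * π * r ^ 2) ^ (-(n : ℝ) / 2) * Real.exp (1 / 8)) *
        ∫⁻ z, ENNReal.ofReal (Real.exp (-(1 / (16 * r ^ 2)) * ‖z - x‖ ^ 2)) *
          ∫⁻ y in ball z r, ‖heatExt n f s y‖ₑ ^ 2 := by
  have hs0 := hs.1
  have hsr := hs.2
  have hJ := enorm_heatExt_add_sq_le hf (a := 2 * r ^ 2 - s) (by linarith) hs0 x
  rw [sub_add_cancel] at hJ
  have hu : Measurable fun y => ‖heatExt n f s y‖ₑ ^ 2 :=
    ((measurable_heatExt_uncurry hf).comp measurable_prodMk_left).enorm.pow_const 2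
  exact (mul_le_mul_right hJ _).trans
    (volume_ball_mul_lintegral_heatKernel_le hr (by linarith) (by linarith) hu x)

lemma volume_ball_mul_enorm_heatExt_sq_mul_le {n : ℕ} {α : ℝ} (hα : 0 ≤ α)
    {f : EuclideanSpace ℝ (Fin n) → ℂ} (hf : Measurable f) {r : ℝ} (hr : 0 < r)
    (x : EuclideanSpace ℝ (Fin n)) :
    volume (ball (0 : EuclideanSpace ℝ (Fin n)) r) * ‖heatExt n f (2 * r ^ 2) x‖ₑ ^ 2 *
        ENNReal.ofReal (r ^ (-(2 * α))) * ENNReal.ofReal (r ^ 2) ≤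
      ENNReal.ofReal (2 ^ n * Real.exp (1 / 8)) *
        (ENNReal.ofReal (r ^ ((n : ℝ) - 2 * α)) * QinvNorm n α f ^ 2) := by
  have hw {s : ℝ} (hs : s ∈ Set.Ioo 0 (r ^ 2)) : r ^ (-(2 * α)) ≤ s ^ (-α) := by
    rw [← mul_neg, Real.rpow_mul hr.le, Real.rpow_two]
    exact Real.rpow_le_rpow_of_nonpos hs.1 hs.2.le (by linarith)
  have hE : Measurable fun z : EuclideanSpace ℝ (Fin n) =>
    ENNReal.ofReal (Real.exp (-(1 / (16 * r ^ 2)) * ‖z - x‖ ^ 2)) := by fun_prop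
  have hG := measurable_setLIntegral_ball
    (F := fun p => ‖heatExt n f p.1 p.2‖ₑ ^ 2) ((measurable_heatExt_uncurry hf).enorm.pow_const 2) r
  have hswap := setLIntegral_lintegral_mul_swap (μ := volume) hE hG
    (w := fun s => ENNReal.ofReal (s ^ (-α))) (by fun_prop) (Set.Ioo 0 (r ^ 2))
  rw [← gaussian_const_mul hr, ENNReal.ofReal_mul (by positivity),
    ← lintegral_exp_neg_mul_norm_sub_sq (by positivity) x, mul_assoc (ENNReal.ofReal _),
    ← lintegral_mul_const _ hE]
  refine le_trans ?_ (mul_le_mul_right (lintegral_mono fun z =>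
    mul_le_mul_right (setLIntegral_le_QinvNorm_sq α f hr z) _) _)
  rw [← hswap, ← lintegral_const_mul' _ _ ENNReal.ofReal_ne_top]
  have hvol : ENNReal.ofReal (r ^ 2) = volume (Set.Ioo 0 (r ^ 2)) := by
    rw [Real.volume_Ioo, sub_zero]
  rw [hvol, ← setLIntegral_const]
  refine setLIntegral_mono' measurableSet_Ioo fun s hs => ?_
  rw [← mul_assoc (ENNReal.ofReal _)]
  exact mul_le_mul' (volume_ball_mul_enorm_heatExt_sq_le hf hs hr x)
    (ENNReal.ofReal_le_ofReal (hw hs))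

lemma volume_unitBall_mul_enorm_heatExt_sq_le {n : ℕ} {α : ℝ} (hα : 0 ≤ α)
    {f : EuclideanSpace ℝ (Fin n) → ℂ} (hf : Measurable f) {r : ℝ} (hr : 0 < r)
    (x : EuclideanSpace ℝ (Fin n)) :
    volume (ball (0 : EuclideanSpace ℝ (Fin n)) 1) *
        (ENNReal.ofReal (r ^ 2) * ‖heatExt n f (2 * r ^ 2) x‖ₑ ^ 2) ≤
      ENNReal.ofReal (2 ^ n * Real.exp (1 / 8)) * QinvNorm n α f ^ 2 := by
  have h := volume_ball_mul_enorm_heatExt_sq_mul_le hα hf hr x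
  have hp : ENNReal.ofReal (r ^ n) * ENNReal.ofReal (r ^ (-(2 * α))) =
      ENNReal.ofReal (r ^ ((n : ℝ) - 2 * α)) := by
    rw [← ENNReal.ofReal_mul (by positivity), ← Real.rpow_natCast, ← Real.rpow_add hr,
      sub_eq_add_neg]
  have h0 : ENNReal.ofReal (r ^ ((n : ℝ) - 2 * α)) ≠ 0 := by
    rw [Ne, ENNReal.ofReal_eq_zero, not_le]
    positivity
  rw [Measure.addHaar_ball_of_pos _ _ hr, finrank_euclideanSpace_fin] at h
  refine (ENNReal.mul_le_mul_iff_right h0 ENNReal.ofReal_ne_top).1 ?_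
  calc _ = _ := by rw [← hp]; ring
    _ ≤ _ := h
    _ = _ := by ring

/-- `t^{1/2} ‖e^{tΔ}f‖_{L^∞} ≤ C ‖f‖_{Q_α^{-1}}` for all `t > 0`. -/
theorem heat_ext_Linfty_bound (n : ℕ) (hn : 1 ≤ n) (α : ℝ) (hα0 : 0 ≤ α) (hα1 : α < 1) :
    ∃ C > (0 : ℝ), ∀ f : EuclideanSpace ℝ (Fin n) → ℂ,
      Measurable f → QinvNorm n α f ≠ ⊤ → ∀ t > (0 : ℝ),
        ENNReal.ofReal (t ^ (1 / 2 : ℝ)) * eLpNorm (heatExt n f t) ⊤ volume ≤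
          ENNReal.ofReal C * QinvNorm n α f := by
  set V := volume (ball (0 : EuclideanSpace ℝ (Fin n)) 1) with hV
  have hV0 : V ≠ 0 := (measure_ball_pos _ _ one_pos).ne'
  have hVt : V ≠ ⊤ := measure_ball_lt_top.ne
  have hVr : 0 < V.toReal := ENNReal.toReal_pos hV0 hVt
  refine ⟨√(2 * (2 ^ n * Real.exp (1 / 8)) / V.toReal), by positivity, fun f hf _ t ht => ?_⟩
  have hpt (x : EuclideanSpace ℝ (Fin n)) : ENNReal.ofReal (t ^ (1 / 2 : ℝ)) * ‖heatExt n f t x‖ₑ ≤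
      ENNReal.ofReal √(2 * (2 ^ n * Real.exp (1 / 8)) / V.toReal) * QinvNorm n α f := by
    have hr2 : √(t / 2) ^ 2 = t / 2 := Real.sq_sqrt (by positivity)
    have h := volume_unitBall_mul_enorm_heatExt_sq_le hα0 hf (r := √(t / 2)) (by positivity) x
    rw [hr2, mul_div_cancel₀ t two_ne_zero, ← hV] at h
    rw [← ENNReal.pow_le_pow_left_iff two_ne_zero, mul_pow, mul_pow,
      ← ENNReal.ofReal_pow (by positivity), ← ENNReal.ofReal_pow (by positivity),
      Real.sq_sqrt (by positivity), ← Real.sqrt_eq_rpow, Real.sq_sqrt ht.le]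
    refine (ENNReal.mul_le_mul_iff_right hV0 hVt).1 ?_
    calc V * (ENNReal.ofReal t * ‖heatExt n f t x‖ₑ ^ 2)
        = ENNReal.ofReal 2 * (V * (ENNReal.ofReal (t / 2) * ‖heatExt n f t x‖ₑ ^ 2)) := by
          rw [show ENNReal.ofReal t = ENNReal.ofReal 2 * ENNReal.ofReal (t / 2) by
            rw [← ENNReal.ofReal_mul (by norm_num)]; congr 1; ring]
          ring
      _ ≤ ENNReal.ofReal 2 * (ENNReal.ofReal (2 ^ n * Real.exp (1 / 8)) * QinvNorm n α f ^ 2) := by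
          gcongr
      _ = _ := by
          rw [← mul_assoc, ← mul_assoc, ← ENNReal.ofReal_mul (by norm_num)]
          congr 1
          nth_rewrite 1 [← ENNReal.ofReal_toReal hVt]
          rw [← ENNReal.ofReal_mul hVr.le, mul_div_cancel₀ _ hVr.ne']
  have ht0 : ENNReal.ofReal (t ^ (1 / 2 : ℝ)) ≠ 0 := by
    rw [Ne, ENNReal.ofReal_eq_zero, not_le]
    positivity
  rw [mul_comm, ← ENNReal.le_div_iff_mul_le (.inl ht0) (.inl ENNReal.ofReal_ne_top),
    eLpNorm_exponent_top]
  refine eLpNormEssSup_le_of_ae_enorm_bound (.of_forall fun x => ?_)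
  rw [ENNReal.le_div_iff_mul_le (.inl ht0) (.inl ENNReal.ofReal_ne_top), mul_comm]
  exact hpt x
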